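/- Let ℋ be the Iwahori–Hecke algebra of a Coxeter system (W,S) with positive parameters, and let I, J ⊆ S be spherical (W_I, W_J finite). For w the minimal-length (I,J)-reduced representative, define P_w^{IJ} = [N(I)/N(I∩wJw⁻¹)] · 1_I T_w 1_J. Then P_w^{IJ} = N(J)⁻¹ Σ_{z ∈ W_I w W_J} T_z. -/

import Mathlib

open CoxeterSystem

namespace CoxeterSystem

variable {B W : Type*} [Group W] {M : CoxeterMatrix B} (cs : CoxeterSystem M W)

theorem prod_map_alternatingWord {G : Type*} [Monoid G] (f : B → G) (i j : B) (n : ℕ) :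
    ((alternatingWord i j (2 * n)).map f).prod = (f i * f j) ^ n := by
  induction n with
  | zero => simp [alternatingWord]
  | succ n ih =>
    rw [show 2 * (n + 1) = 2 * n + 1 + 1 by ring, alternatingWord_succ, alternatingWord_succ]
    simp [ih, pow_succ]

theorem inv_pow_mul_simple (i j : B) (n : ℕ) :
    ((cs.simple i * cs.simple j) ^ n)⁻¹ * cs.simple j =
      cs.simple j * (cs.simple i * cs.simple j) ^ n := by
  induction n with
  | zero => simp
  | succ n ih =>
    rw [pow_succ, mul_inv_rev, mul_assoc, ih, ← pow_succ, pow_succ']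
    simp [mul_assoc]

theorem rightInvSeq_alternatingWord (i j : B) (n : ℕ) :
    cs.rightInvSeq (alternatingWord i j n) =
      ((List.range n).map fun k ↦ cs.simple j * (cs.simple i * cs.simple j) ^ k).reverse := by
  induction n with
  | zero => simp [alternatingWord]
  | succ n ih =>
    rw [alternatingWord_succ', rightInvSeq, ih, List.range_succ, List.map_append,
      List.reverse_append, List.map_singleton, List.reverse_singleton, List.singleton_append,
      prod_alternatingWord_eq_mul_pow]
    congr 1
    rcases Nat.even_or_odd' n with ⟨k, rfl | rfl⟩
    · have h : 2 * k / 2 = k := by omega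
      simp only [h, even_two_mul, if_true, one_mul, inv_pow_mul_simple]
      rw [mul_assoc, ← pow_add, two_mul]
    · have h : (2 * k + 1) / 2 = k := by omega
      have h' : ¬ Even (2 * k + 1) := by simp
      simp only [h, h', if_false, mul_inv_rev, inv_simple, inv_pow_mul_simple]
      rw [show 2 * k + 1 = k + (1 + k) by ring, pow_add, pow_add, pow_one]
      simp [mul_assoc]

open Classical in
theorem even_count_rightInvSeq_alternatingWord (i j : B) (t : W) :
    Even ((cs.rightInvSeq (alternatingWord i j (2 * M i j))).count t) := by
  rw [rightInvSeq_alternatingWord, List.count_reverse, two_mul, List.range_add, List.map_append,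
    List.count_append, List.map_map]
  simp [Function.comp_def, pow_add]

open Classical in
/-- The involution of `W × ZMod 2` attached to a simple reflection, whose second component
records the parity of the number of times a given element occurs in an inversion sequence. -/
noncomputable def parityAction (i : B) : Function.End (W × ZMod 2) :=
  fun p ↦ (cs.simple i * p.1 * cs.simple i, p.2 + if p.1 = cs.simple i then 1 else 0)

open Classical in
theorem prod_map_parityAction (ω : List B) (t : W) (e : ZMod 2) :
    (ω.map cs.parityAction).prod (t, e) =
      (cs.wordProd ω * t * (cs.wordProd ω)⁻¹, e + ((cs.rightInvSeq ω).count t : ℕ)) := by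
  induction ω with
  | nil => simp; rfl
  | cons i ω ih =>
    rw [List.map_cons, List.prod_cons]
    change cs.parityAction i ((ω.map cs.parityAction).prod (t, e)) = _
    rw [ih, wordProd_cons, rightInvSeq, List.count_cons]
    have : (cs.wordProd ω * t * (cs.wordProd ω)⁻¹ = cs.simple i) ↔
        ((cs.wordProd ω)⁻¹ * cs.simple i * cs.wordProd ω = t) := by
      constructor
      · intro h; rw [← h]; group
      · intro h; rw [← h]; group
    simp only [parityAction, this, beq_iff_eq]
    ext
    · simp [mul_assoc]
    · push_cast; simp [add_assoc]

theorem isLiftable_parityAction : M.IsLiftable cs.parityAction := by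
  classical
  intro i j
  rw [← prod_map_alternatingWord]
  funext ⟨t, e⟩
  rw [prod_map_parityAction, (ZMod.natCast_eq_zero_iff_even).2
    (cs.even_count_rightInvSeq_alternatingWord i j t), wordProd, prod_map_alternatingWord]
  simp; rfl

open Classical in
/-- The parity of the multiplicity of `t` in the inversion sequence of a word depends only on
the product of the word. -/
theorem count_rightInvSeq_eq_of_wordProd_eq {ω ω' : List B} (h : cs.wordProd ω = cs.wordProd ω')
    (t : W) : (((cs.rightInvSeq ω).count t : ℕ) : ZMod 2) = ((cs.rightInvSeq ω').count t : ℕ) := by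
  have key (ω : List B) : cs.lift ⟨cs.parityAction, cs.isLiftable_parityAction⟩ (cs.wordProd ω) =
      (ω.map cs.parityAction).prod := by
    rw [wordProd, map_list_prod, List.map_map]
    congr 2
    funext i
    exact cs.lift_apply_simple _ i
  have := congrFun ((key ω).symm.trans ((congrArg _ h).trans (key ω'))) (t, 0)
  rw [prod_map_parityAction, prod_map_parityAction] at this
  simpa using congrArg Prod.snd this

/-- The exchange property. -/
theorem exists_wordProd_mul_simple_eq_eraseIdx {ω : List B} {i : B}
    (h : cs.IsRightDescent (cs.wordProd ω) i) :
    ∃ k < ω.length, cs.wordProd ω * cs.simple i = cs.wordProd (ω.eraseIdx k) := by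
  classical
  obtain ⟨ω', hω', h'⟩ := cs.exists_isReduced (cs.wordProd ω * cs.simple i)
  have hprod : cs.wordProd (ω'.concat i) = cs.wordProd ω := by
    rw [wordProd_concat, ← h', simple_mul_simple_cancel_right]
  have hred : cs.IsReduced (ω'.concat i) := by
    rw [IsReduced, hprod, ← cs.isRightDescent_iff.1 h, h', hω'.eq, List.length_concat]
  have hmem : cs.simple i ∈ cs.rightInvSeq (ω'.concat i) := by
    rw [rightInvSeq_concat]; simp
  have hcount := cs.count_rightInvSeq_eq_of_wordProd_eq hprod (cs.simple i)
  rw [List.count_eq_one_of_mem hred.nodup_rightInvSeq hmem] at hcount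
  have hmem' : cs.simple i ∈ cs.rightInvSeq ω := by
    by_contra hn
    rw [List.count_eq_zero_of_not_mem hn] at hcount
    simp at hcount
  obtain ⟨k, hk, hk'⟩ := List.getElem_of_mem hmem'
  refine ⟨k, by simpa using hk, ?_⟩
  rw [← wordProd_mul_getD_rightInvSeq, List.getD_eq_getElem _ _ hk, hk']

/-- The exchange property for the concatenation of two words. -/
theorem exchange_mul {α ω : List B} {i : B}
    (h : cs.IsRightDescent (cs.wordProd α * cs.wordProd ω) i) :
    (∃ k < α.length, cs.wordProd α * cs.wordProd ω * cs.simple i =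
        cs.wordProd (α.eraseIdx k) * cs.wordProd ω) ∨
      ∃ k < ω.length, cs.wordProd ω * cs.simple i = cs.wordProd (ω.eraseIdx k) := by
  rw [← wordProd_append] at h
  obtain ⟨k, hk, hk'⟩ := cs.exists_wordProd_mul_simple_eq_eraseIdx h
  rw [wordProd_append] at hk'
  rcases lt_or_ge k α.length with hlt | hge
  · left
    rw [List.eraseIdx_append_of_lt_length hlt, wordProd_append] at hk'
    exact ⟨k, hlt, hk'⟩
  · right
    rw [List.eraseIdx_append_of_length_le hge, wordProd_append, mul_assoc] at hk'
    rw [List.length_append] at hk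
    exact ⟨k - α.length, by omega, mul_left_cancel hk'⟩

theorem length_wordProd_eraseIdx_lt {ω : List B} {k : ℕ} (hk : k < ω.length) :
    cs.length (cs.wordProd (ω.eraseIdx k)) < ω.length := by
  have := cs.length_wordProd_le (ω.eraseIdx k)
  have := List.length_eraseIdx_add_one hk
  omega

theorem wordProd_mem_closure {J : Set B} {ω : List B} (h : ∀ i ∈ ω, i ∈ J) :
    cs.wordProd ω ∈ Subgroup.closure (cs.simple '' J) := by
  refine Subgroup.list_prod_mem _ fun x hx ↦ ?_
  obtain ⟨i, hi, rfl⟩ := List.mem_map.1 hx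
  exact Subgroup.subset_closure ⟨i, h i hi, rfl⟩

/-- Elements of a standard parabolic subgroup have reduced words in its generators. -/
theorem exists_isReduced_of_mem_closure {J : Set B} {y : W}
    (hy : y ∈ Subgroup.closure (cs.simple '' J)) :
    ∃ ω : List B, cs.IsReduced ω ∧ (∀ i ∈ ω, i ∈ J) ∧ y = cs.wordProd ω := by
  have step (y : W) (i : B) (hi : i ∈ J)
      (h : ∃ ω : List B, cs.IsReduced ω ∧ (∀ i ∈ ω, i ∈ J) ∧ y = cs.wordProd ω) :
      ∃ ω : List B, cs.IsReduced ω ∧ (∀ i ∈ ω, i ∈ J) ∧ y * cs.simple i = cs.wordProd ω := by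
    obtain ⟨ω, hω, hJ, rfl⟩ := h
    by_cases hd : cs.IsRightDescent (cs.wordProd ω) i
    · obtain ⟨k, hk, hk'⟩ := cs.exists_wordProd_mul_simple_eq_eraseIdx hd
      refine ⟨_, ?_, fun j hj ↦ hJ j (List.mem_of_mem_eraseIdx hj), hk'⟩
      have h1 := cs.isRightDescent_iff.1 hd
      rw [hk', hω.eq, ← List.length_eraseIdx_add_one hk] at h1
      exact Nat.add_right_cancel h1
    · refine ⟨ω.concat i, ?_, ?_, by rw [wordProd_concat]⟩
      · rw [IsReduced, wordProd_concat, cs.not_isRightDescent_iff.1 hd, hω.eq, List.length_concat]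
      · simp only [List.concat_eq_append, List.mem_append, List.mem_singleton]
        rintro j (hj | rfl)
        exacts [hJ j hj, hi]
  induction hy using Subgroup.closure_induction_right with
  | one => exact ⟨[], by simp [IsReduced], by simp, by simp⟩
  | mul_right y hy s hs ih =>
    obtain ⟨i, hi, rfl⟩ := hs
    exact step y i hi ih
  | mul_inv_cancel y hy s hs ih =>
    obtain ⟨i, hi, rfl⟩ := hs
    rw [inv_simple]
    exact step y i hi ih

/-- A minimal element of a coset `w W_J` is length-additive with `W_J`. -/
theorem length_mul_of_minimal {J : Set B} {w : W}
    (hw : ∀ y ∈ Subgroup.closure (cs.simple '' J), cs.length w ≤ cs.length (w * y))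
    {y : W} (hy : y ∈ Subgroup.closure (cs.simple '' J)) :
    cs.length (w * y) = cs.length w + cs.length y := by
  obtain ⟨ω, hω, hJ, rfl⟩ := cs.exists_isReduced_of_mem_closure hy
  clear hy
  induction ω using List.reverseRecOn with
  | nil => simp
  | append_singleton ω i ih =>
    have hω' : cs.IsReduced ω := by simpa using hω.take ω.length
    have hJ' : ∀ j ∈ ω, j ∈ J := fun j hj ↦ hJ j (by simp [hj])
    have hi : i ∈ J := hJ i (by simp)
    have ih := ih hω' hJ'
    rw [hω.eq, wordProd_append, wordProd_singleton, ← mul_assoc, List.length_append,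
      List.length_singleton, ← add_assoc, ← hω'.eq, ← ih, ← cs.not_isRightDescent_iff]
    intro hd
    obtain ⟨α, hα, rfl⟩ := cs.exists_isReduced w
    rcases cs.exchange_mul hd with ⟨k, hk, he⟩ | ⟨k, hk, he⟩
    · have hy := cs.wordProd_mem_closure hJ'
      have h1 := hw (cs.wordProd ω * cs.simple i * (cs.wordProd ω)⁻¹)
        (mul_mem (mul_mem hy (Subgroup.subset_closure ⟨i, hi, rfl⟩)) (inv_mem hy))
      rw [← mul_assoc, ← mul_assoc, he, mul_inv_cancel_right, hα.eq] at h1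
      exact h1.not_gt (cs.length_wordProd_eraseIdx_lt hk)
    · have h1 := hω.eq
      rw [wordProd_append, wordProd_singleton, he, List.length_append, List.length_singleton] at h1
      have := cs.length_wordProd_eraseIdx_lt hk
      omega

theorem length_mul_of_minimal_left {I : Set B} {w : W}
    (hw : ∀ x ∈ Subgroup.closure (cs.simple '' I), cs.length w ≤ cs.length (x * w))
    {x : W} (hx : x ∈ Subgroup.closure (cs.simple '' I)) :
    cs.length (x * w) = cs.length x + cs.length w := by
  have := cs.length_mul_of_minimal (J := I) (w := w⁻¹)
    (fun y hy ↦ by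
      rw [← cs.length_inv (w⁻¹ * y), mul_inv_rev, inv_inv, length_inv]
      exact hw _ (inv_mem hy)) (inv_mem hx)
  rwa [← mul_inv_rev, length_inv, length_inv, length_inv, add_comm] at this

theorem isReduced_of_isReduced_append_singleton {ω : List B} {i : B}
    (h : cs.IsReduced (ω ++ [i])) : cs.IsReduced ω := by
  simpa using h.take ω.length

theorem length_mul_simple_of_isReduced_append {ω : List B} {i : B}
    (h : cs.IsReduced (ω ++ [i])) :
    cs.length (cs.wordProd ω * cs.simple i) = cs.length (cs.wordProd ω) + 1 := by
  rw [(cs.isReduced_of_isReduced_append_singleton h).eq]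
  simpa [wordProd_append] using h.eq

theorem exists_simple_eq_of_length_eq_one {J : Set B} {y : W}
    (hy : y ∈ Subgroup.closure (cs.simple '' J)) (h : cs.length y = 1) :
    ∃ i ∈ J, y = cs.simple i := by
  obtain ⟨ω, hω, hJ, rfl⟩ := cs.exists_isReduced_of_mem_closure hy
  rw [hω.eq, List.length_eq_one_iff] at h
  obtain ⟨i, rfl⟩ := h
  exact ⟨i, hJ i (by simp), by simp⟩

section Weight

variable {q : B → ℝ} {Q : W → ℝ}
  (hQ : ∀ ω : List B, cs.IsReduced ω → Q (cs.wordProd ω) = (ω.map q).prod)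
include hQ

theorem weight_mul_simple {w : W} {i : B}
    (h : cs.length (w * cs.simple i) = cs.length w + 1) : Q (w * cs.simple i) = Q w * q i := by
  obtain ⟨ω, hω, rfl⟩ := cs.exists_isReduced w
  rw [← wordProd_concat, hQ ω hω, hQ]
  · simp
  · rw [IsReduced, wordProd_concat, h, hω.eq, List.length_concat]

theorem weight_pos (hq : ∀ i, 0 < q i) (w : W) : 0 < Q w := by
  obtain ⟨ω, hω, rfl⟩ := cs.exists_isReduced w
  rw [hQ ω hω]
  refine List.prod_pos fun a ha ↦ ?_
  obtain ⟨i, -, rfl⟩ := List.mem_map.1 ha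
  exact hq i

end Weight

/-- If `w` is minimal in `W_I w W_J`, then `W_I ∩ w W_J w⁻¹` is the standard parabolic subgroup on
`I ∩ w J w⁻¹`, and conjugation by `w` preserves weights on it. -/
theorem mem_closure_and_weight_eq_of_conj {q : B → ℝ} {Q : W → ℝ}
    (hQ : ∀ ω : List B, cs.IsReduced ω → Q (cs.wordProd ω) = (ω.map q).prod)
    (hq : ∀ i j : B, IsConj (cs.simple i) (cs.simple j) → q i = q j) {I J : Set B} {w : W}
    (hw : ∀ x ∈ Subgroup.closure (cs.simple '' I), ∀ y ∈ Subgroup.closure (cs.simple '' J),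
      cs.length w ≤ cs.length (x * w * y)) {x y : W}
    (hx : x ∈ Subgroup.closure (cs.simple '' I)) (hy : y ∈ Subgroup.closure (cs.simple '' J))
    (h : x * w = w * y) :
    x ∈ Subgroup.closure {s | s ∈ cs.simple '' I ∧ w⁻¹ * s * w ∈ cs.simple '' J} ∧ Q x = Q y := by
  have hwI : ∀ x ∈ Subgroup.closure (cs.simple '' I), cs.length w ≤ cs.length (x * w) :=
    fun x hx ↦ by simpa using hw x hx 1 (one_mem _)
  have hwJ : ∀ y ∈ Subgroup.closure (cs.simple '' J), cs.length w ≤ cs.length (w * y) :=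
    fun y hy ↦ by simpa using hw 1 (one_mem _) y hy
  obtain ⟨ω, hω, hJ, rfl⟩ := cs.exists_isReduced_of_mem_closure hy
  clear hy
  induction ω using List.reverseRecOn generalizing x with
  | nil =>
    have : x = 1 := by simpa using h
    subst this
    simp
  | append_singleton ω t ih =>
    have hlen := cs.length_mul_simple_of_isReduced_append hω
    replace hω := cs.isReduced_of_isReduced_append_singleton hω
    have ht : t ∈ J := hJ t (by simp)
    replace hJ : ∀ j ∈ ω, j ∈ J := fun j hj ↦ hJ j (by simp [hj])
    have htJ : cs.simple t ∈ Subgroup.closure (cs.simple '' J) :=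
      Subgroup.subset_closure ⟨t, ht, rfl⟩
    have hωJ := cs.wordProd_mem_closure hJ
    rw [wordProd_append, wordProd_singleton] at h ⊢
    have hlx : cs.length x = cs.length (cs.wordProd ω) + 1 := by
      have h1 := cs.length_mul_of_minimal_left hwI hx
      rw [h, cs.length_mul_of_minimal hwJ (mul_mem hωJ htJ), hlen] at h1
      omega
    have hwt := cs.length_mul_of_minimal hwJ htJ
    rw [length_simple] at hwt
    obtain ⟨α, hα, hαI, hxα⟩ := cs.exists_isReduced_of_mem_closure hx
    obtain ⟨β, hβ, hwβ⟩ := cs.exists_isReduced w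
    have hxwt : x * w * cs.simple t = w * cs.wordProd ω := by
      rw [h]; simp [mul_assoc]
    have hd : cs.IsRightDescent (cs.wordProd α * cs.wordProd β) t := by
      rw [← hxα, ← hwβ, IsRightDescent, hxwt, cs.length_mul_of_minimal hwJ hωJ,
        cs.length_mul_of_minimal_left hwI hx]
      omega
    rcases cs.exchange_mul hd with ⟨k, hk, he⟩ | ⟨k, hk, he⟩
    · rw [← hxα, ← hwβ] at he
      have hx' : cs.wordProd (α.eraseIdx k) ∈ Subgroup.closure (cs.simple '' I) :=
        cs.wordProd_mem_closure fun j hj ↦ hαI j (List.mem_of_mem_eraseIdx hj)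
      generalize cs.wordProd (α.eraseIdx k) = x' at he hx'
      have hconj : x⁻¹ * x' = w * cs.simple t * w⁻¹ := by
        rw [eq_mul_inv_iff_mul_eq, mul_assoc, ← he]; simp [mul_assoc]
      have hs := mul_mem (inv_mem hx) hx'
      obtain ⟨s, hsI, hs'⟩ := cs.exists_simple_eq_of_length_eq_one hs (by
        have h1 := cs.length_mul_of_minimal_left hwI hs
        rw [hconj, inv_mul_cancel_right, hwt] at h1
        rw [hconj]
        omega)
      have hx's : x = x' * cs.simple s := by
        rw [← hs']
        have : cs.simple s * cs.simple s = 1 := cs.simple_mul_simple_self s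
        rw [← hs'] at this
        calc x = x * (x⁻¹ * x' * (x⁻¹ * x')) := by rw [this, mul_one]
          _ = _ := by group
      have hst : cs.simple s = w * cs.simple t * w⁻¹ := hs'.symm.trans hconj
      obtain ⟨hmem, hweight⟩ := ih hx' hω hJ (he.symm.trans hxwt)
      have hlx' : cs.length (x' * cs.simple s) = cs.length x' + 1 := by
        rw [← hx's, hlx]
        have h1 := cs.length_mul_of_minimal_left hwI hx'
        rw [← he, hxwt, cs.length_mul_of_minimal hwJ hωJ] at h1
        omega
      constructor
      · rw [hx's]
        refine mul_mem hmem (Subgroup.subset_closure ⟨⟨s, hsI, rfl⟩, t, ht, ?_⟩)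
        rw [hst]; group
      · rw [hx's, cs.weight_mul_simple hQ hlx', cs.weight_mul_simple hQ hlen, hweight,
          hq s t (isConj_iff.2 ⟨w⁻¹, by rw [hst]; group⟩)]
    · have := cs.length_wordProd_eraseIdx_lt hk
      rw [← he, ← hwβ, hwt, ← hβ.eq, ← hwβ] at this
      omega

end CoxeterSystem

/-- `R` acts on the family `T` as multiplication by a simple generator of a Hecke algebra with
parameter `q` acts on the standard basis, `σ` being the underlying action on the index set. -/
structure IsHeckeStep {W H : Type*} [AddCommGroup H] [Module ℂ H] (T : W → H) (len : W → ℕ)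
    (σ : W → W) (q : ℂ) (R : H →ₗ[ℂ] H) : Prop where
  invol : ∀ z, σ (σ z) = z
  len_step : ∀ z, len (σ z) = len z + 1 ∨ len (σ z) + 1 = len z
  asc : ∀ z, len (σ z) = len z + 1 → R (T z) = T (σ z)
  desc : ∀ z, len (σ z) + 1 = len z → R (T z) = q • T (σ z) + (q - 1) • T z

namespace IsHeckeStep

variable {W H : Type*} [AddCommGroup H] [Module ℂ H] {T : W → H} {len : W → ℕ} {σ : W → W} {q : ℂ}
  {R : H →ₗ[ℂ] H}

theorem map_sum_eq_smul (h : IsHeckeStep T len σ q R) {F : Finset W} (hF : ∀ z ∈ F, σ z ∈ F) :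
    R (∑ z ∈ F, T z) = q • ∑ z ∈ F, T z := by
  rw [map_sum, Finset.smul_sum, ← sub_eq_zero, ← Finset.sum_sub_distrib]
  refine Finset.sum_involution (fun z _ ↦ σ z) (fun z _ ↦ ?_) (fun z _ _ he ↦ ?_) hF
    (fun z _ ↦ h.invol z)
  · have h2 := h.invol z
    rcases h.len_step z with h1 | h1
    · rw [h.asc z h1, h.desc (σ z) (by rw [h2, h1]), h2]
      module
    · rw [h.desc z h1, h.asc (σ z) (by rw [h2, h1]), h2]
      module
  · have := h.len_step z
    rw [he] at this
    omega

theorem map_mem_span (h : IsHeckeStep T len σ q R) {C : Set W} (hC : ∀ z ∈ C, σ z ∈ C) {x : H}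
    (hx : x ∈ Submodule.span ℂ (T '' C)) : R x ∈ Submodule.span ℂ (T '' C) := by
  have mem {z : W} (hz : z ∈ C) : T z ∈ Submodule.span ℂ (T '' C) :=
    Submodule.subset_span ⟨z, hz, rfl⟩
  induction hx using Submodule.span_induction with
  | zero => simp
  | add x y _ _ hx hy => rw [map_add]; exact add_mem hx hy
  | smul a x _ hx => rw [map_smul]; exact Submodule.smul_mem _ _ hx
  | mem x hx =>
    obtain ⟨z, hz, rfl⟩ := hx
    rcases h.len_step z with h1 | h1
    · rw [h.asc z h1]; exact mem (hC z hz)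
    · rw [h.desc z h1]
      exact add_mem (Submodule.smul_mem _ _ (mem (hC z hz))) (Submodule.smul_mem _ _ (mem hz))

theorem coord_map (h : IsHeckeStep T len σ q R) {ψ : H →ₗ[ℂ] W →₀ ℂ}
    (hψ : ∀ z, ψ (T z) = Finsupp.single z 1) {x : H} (hx : x ∈ Submodule.span ℂ (Set.range T))
    {z : W} (hz : len (σ z) = len z + 1) : ψ (R x) z = q * ψ x (σ z) := by
  classical
  induction hx using Submodule.span_induction with
  | zero => simp
  | add x y _ _ hx hy => simp [hx, hy, mul_add]
  | smul a x _ hx => simp [hx, mul_left_comm]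
  | mem x hx =>
    obtain ⟨v, rfl⟩ := hx
    have h2 := h.invol z
    have h3 := h.invol v
    rcases h.len_step v with h1 | h1
    · have hv : σ v ≠ z := by rintro rfl; rw [h3] at hz; omega
      have hv' : v ≠ σ z := by rintro rfl; rw [h2] at h1; omega
      rw [h.asc v h1, hψ, hψ, Finsupp.single_eq_of_ne hv.symm, Finsupp.single_eq_of_ne hv'.symm,
        mul_zero]
    · have hv : v ≠ z := by rintro rfl; omega
      have hv' : σ v = z ↔ v = σ z := ⟨fun h ↦ by rw [← h, h3], fun h ↦ by rw [h, h2]⟩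
      simp [h.desc v h1, hψ, Finsupp.single_apply, hv, hv']

theorem coord_eq (h : IsHeckeStep T len σ q R) (hq : q ≠ 0) {ψ : H →ₗ[ℂ] W →₀ ℂ}
    (hψ : ∀ z, ψ (T z) = Finsupp.single z 1) {x : H} (hx : x ∈ Submodule.span ℂ (Set.range T))
    (hR : R x = q • x) (z : W) : ψ x (σ z) = ψ x z := by
  have key {z : W} (hz : len (σ z) = len z + 1) : ψ x (σ z) = ψ x z := by
    have := h.coord_map hψ hx hz
    rw [hR, map_smul, Finsupp.smul_apply, smul_eq_mul] at this
    exact (mul_left_cancel₀ hq this).symm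
  rcases h.len_step z with h1 | h1
  · exact key h1
  · rw [← key (z := σ z) (by rw [h.invol, h1]), h.invol]

end IsHeckeStep

theorem coord_eq_zero_of_notMem {W H : Type*} [AddCommGroup H] [Module ℂ H] {T : W → H}
    {ψ : H →ₗ[ℂ] W →₀ ℂ} (hψ : ∀ z, ψ (T z) = Finsupp.single z 1) {C : Set W} {x : H}
    (hx : x ∈ Submodule.span ℂ (T '' C)) {z : W} (hz : z ∉ C) : ψ x z = 0 := by
  induction hx using Submodule.span_induction with
  | zero => simp
  | add x y _ _ hx hy => simp [hx, hy]
  | smul a x _ hx => simp [hx]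
  | mem x hx =>
    obtain ⟨v, hv, rfl⟩ := hx
    rw [hψ, Finsupp.single_eq_of_ne]
    rintro rfl
    exact hz hv

theorem eq_sum_coord_smul {W H : Type*} [AddCommGroup H] [Module ℂ H] {T : W → H}
    {ψ : H →ₗ[ℂ] W →₀ ℂ} (hψ : ∀ z, ψ (T z) = Finsupp.single z 1) {F : Finset W} {x : H}
    (hx : x ∈ Submodule.span ℂ (T '' F)) : x = ∑ z ∈ F, ψ x z • T z := by
  classical
  induction hx using Submodule.span_induction with
  | zero => simp
  | add x y _ _ hx hy =>
    simp only [map_add, Finsupp.add_apply, add_smul, Finset.sum_add_distrib, ← hx, ← hy]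
  | smul a x _ hx =>
    simp only [map_smul, Finsupp.smul_apply, smul_assoc, ← Finset.smul_sum, ← hx]
  | mem x hx =>
    obtain ⟨v, hv, rfl⟩ := hx
    rw [hψ, Finset.sum_eq_single v]
    · simp
    · intro z _ hz; simp [Finsupp.single_eq_of_ne hz]
    · intro h; exact absurd hv h

namespace CoxeterSystem

variable {B W : Type*} [Group W] {M : CoxeterMatrix B} (cs : CoxeterSystem M W)
  {H : Type*} [Ring H] [Algebra ℂ H] {T : W → H} (hT1 : T 1 = 1)
  (hasc : ∀ (w : W) (i : B), cs.length (w * cs.simple i) = cs.length w + 1 →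
    T w * T (cs.simple i) = T (w * cs.simple i))

include hT1 hasc in
omit [Algebra ℂ H] in
theorem hecke_mul {u v : W} (h : cs.length (u * v) = cs.length u + cs.length v) :
    T u * T v = T (u * v) := by
  obtain ⟨ω, hω, rfl⟩ := cs.exists_isReduced v
  induction ω using List.reverseRecOn with
  | nil => simp [hT1]
  | append_singleton ω i ih =>
    have hlen := cs.length_mul_simple_of_isReduced_append hω
    rw [wordProd_append, wordProd_singleton, hlen, ← mul_assoc] at h
    have h1 := cs.length_mul_le u (cs.wordProd ω)
    have h2 := cs.length_mul_le (u * cs.wordProd ω) (cs.simple i)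
    rw [length_simple] at h2
    rw [wordProd_append, wordProd_singleton, ← hasc _ _ hlen, ← mul_assoc,
      ih (cs.isReduced_of_isReduced_append_singleton hω) (by omega), hasc _ _ (by omega),
      mul_assoc]

variable {q : B → ℝ}
  (hdesc : ∀ (w : W) (i : B), cs.length (w * cs.simple i) + 1 = cs.length w →
    T w * T (cs.simple i) =
      ((q i : ℂ)) • T (w * cs.simple i) + ((q i : ℂ) - 1) • T w)
include hasc hdesc

theorem isHeckeStep_mulRight (i : B) :
    IsHeckeStep T cs.length (· * cs.simple i) (q i) (LinearMap.mulRight ℂ (T (cs.simple i))) where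
  invol _ := cs.simple_mul_simple_cancel_right i
  len_step _ := cs.length_mul_simple _ i
  asc z := hasc z i
  desc z := hdesc z i

include hT1

theorem isHeckeStep_mulLeft (i : B) :
    IsHeckeStep T cs.length (cs.simple i * ·) (q i) (LinearMap.mulLeft ℂ (T (cs.simple i))) where
  invol _ := cs.simple_mul_simple_cancel_left i
  len_step z := cs.length_simple_mul z i
  asc z h := cs.hecke_mul hT1 hasc (by rw [h, length_simple, add_comm])
  desc z h := by
    have h1 : T (cs.simple i) * T (cs.simple i * z) = T z := by
      rw [cs.hecke_mul hT1 hasc, simple_mul_simple_cancel_left]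
      rw [simple_mul_simple_cancel_left, length_simple, ← h, add_comm]
    have h2 := hdesc (cs.simple i) i (by simp)
    rw [simple_mul_simple_self, hT1] at h2
    rw [LinearMap.mulLeft_apply]
    nth_rw 1 [← h1]
    rw [← mul_assoc, h2, add_mul, smul_mul_assoc, smul_mul_assoc, one_mul, h1]

theorem mul_mem_span_of_mem_closure {J : Set B} {C : Set W}
    (hC : ∀ z ∈ C, ∀ i ∈ J, z * cs.simple i ∈ C) {x : H} (hx : x ∈ Submodule.span ℂ (T '' C)) {y : W}
    (hy : y ∈ Subgroup.closure (cs.simple '' J)) : x * T y ∈ Submodule.span ℂ (T '' C) := by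
  obtain ⟨ω, hω, hJ, rfl⟩ := cs.exists_isReduced_of_mem_closure hy
  clear hy
  induction ω using List.reverseRecOn with
  | nil => simpa [hT1]
  | append_singleton ω i ih =>
    rw [wordProd_append, wordProd_singleton,
      ← hasc _ _ (cs.length_mul_simple_of_isReduced_append hω), ← mul_assoc]
    exact (cs.isHeckeStep_mulRight hasc hdesc i).map_mem_span
      (fun z hz ↦ hC z hz i (hJ i (by simp)))
      (ih (cs.isReduced_of_isReduced_append_singleton hω) fun j hj ↦ hJ j (by simp [hj]))

theorem mul_sum_closure {Q : W → ℝ}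
    (hQ : ∀ ω : List B, cs.IsReduced ω → Q (cs.wordProd ω) = (ω.map q).prod) {J : Set B}
    {F : Finset W} (hF : (F : Set W) = Subgroup.closure (cs.simple '' J)) {y : W} (hy : y ∈ F) :
    T y * ∑ v ∈ F, T v = (Q y : ℂ) • ∑ v ∈ F, T v := by
  have memF (z : W) : z ∈ F ↔ z ∈ Subgroup.closure (cs.simple '' J) := by
    rw [← Finset.mem_coe, hF, SetLike.mem_coe]
  obtain ⟨ω, hω, hJ, rfl⟩ := cs.exists_isReduced_of_mem_closure ((memF y).1 hy)
  clear hy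
  induction ω using List.reverseRecOn with
  | nil =>
    have := hQ [] hω
    rw [wordProd_nil] at this
    simp [hT1, this]
  | append_singleton ω i ih =>
    have hlen := cs.length_mul_simple_of_isReduced_append hω
    rw [wordProd_append, wordProd_singleton, ← hasc _ _ hlen, cs.weight_mul_simple hQ hlen,
      mul_assoc]
    have := (cs.isHeckeStep_mulLeft hT1 hasc hdesc i).map_sum_eq_smul (F := F) fun z hz ↦
      (memF _).2 (mul_mem (Subgroup.subset_closure ⟨i, hJ i (by simp), rfl⟩) ((memF z).1 hz))
    rw [LinearMap.mulLeft_apply] at this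
    rw [this, mul_smul_comm, ih (cs.isReduced_of_isReduced_append_singleton hω)
      fun j hj ↦ hJ j (by simp [hj]), smul_smul, mul_comm (q i : ℂ), Complex.ofReal_mul]

/-- The product of the (unnormalized) parabolic sums with `T w`, for `w` minimal in its double
coset, is a multiple of the double coset sum. -/
theorem sum_mul_mul_sum_eq (hTli : LinearIndependent ℂ T) {Q : W → ℝ} (hqpos : ∀ i, 0 < q i)
    (hqconj : ∀ i j : B, IsConj (cs.simple i) (cs.simple j) → q i = q j)
    (hQ : ∀ ω : List B, cs.IsReduced ω → Q (cs.wordProd ω) = (ω.map q).prod) {I J : Set B} {w : W}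
    (hw : ∀ x ∈ Subgroup.closure (cs.simple '' I), ∀ y ∈ Subgroup.closure (cs.simple '' J),
      cs.length w ≤ cs.length (x * w * y)) {FI FJ FK D : Finset W}
    (hFI : (FI : Set W) = Subgroup.closure (cs.simple '' I))
    (hFJ : (FJ : Set W) = Subgroup.closure (cs.simple '' J))
    (hFK : (FK : Set W) =
      Subgroup.closure {s | s ∈ cs.simple '' I ∧ w⁻¹ * s * w ∈ cs.simple '' J})
    (hD : ∀ z, z ∈ D ↔ ∃ x ∈ FI, ∃ y ∈ FJ, z = x * w * y) :
    (∑ v ∈ FI, T v) * T w * ∑ v ∈ FJ, T v = ((∑ v ∈ FK, Q v : ℝ) : ℂ) • ∑ z ∈ D, T z := by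
  classical
  obtain ⟨ψ, hψ⟩ : ∃ ψ : H →ₗ[ℂ] W →₀ ℂ, ∀ z, ψ (T z) = Finsupp.single z 1 := by
    obtain ⟨ψ, hψ⟩ := (Finsupp.linearCombination ℂ T).exists_leftInverse_of_injective
      (LinearMap.ker_eq_bot.2 hTli)
    exact ⟨ψ, fun z ↦ by simpa using LinearMap.congr_fun hψ (Finsupp.single z 1)⟩
  have memI (z : W) : z ∈ FI ↔ z ∈ Subgroup.closure (cs.simple '' I) := by
    rw [← Finset.mem_coe, hFI, SetLike.mem_coe]
  have memJ (z : W) : z ∈ FJ ↔ z ∈ Subgroup.closure (cs.simple '' J) := by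
    rw [← Finset.mem_coe, hFJ, SetLike.mem_coe]
  have memK (z : W) : z ∈ FK ↔
      z ∈ Subgroup.closure {s | s ∈ cs.simple '' I ∧ w⁻¹ * s * w ∈ cs.simple '' J} := by
    rw [← Finset.mem_coe, hFK, SetLike.mem_coe]
  have simpleI {i : B} (hi : i ∈ I) : cs.simple i ∈ Subgroup.closure (cs.simple '' I) :=
    Subgroup.subset_closure ⟨i, hi, rfl⟩
  have simpleJ {i : B} (hi : i ∈ J) : cs.simple i ∈ Subgroup.closure (cs.simple '' J) :=
    Subgroup.subset_closure ⟨i, hi, rfl⟩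
  have hwI : ∀ x ∈ Subgroup.closure (cs.simple '' I), cs.length w ≤ cs.length (x * w) :=
    fun x hx ↦ by simpa using hw x hx 1 (one_mem _)
  have hwJ : ∀ y ∈ Subgroup.closure (cs.simple '' J), cs.length w ≤ cs.length (w * y) :=
    fun y hy ↦ by simpa using hw 1 (one_mem _) y hy
  have hTxw {x : W} (hx : x ∈ FI) : T x * T w = T (x * w) :=
    cs.hecke_mul hT1 hasc (cs.length_mul_of_minimal_left hwI ((memI x).1 hx))
  have hTwy {y : W} (hy : y ∈ FJ) : T w * T y = T (w * y) :=
    cs.hecke_mul hT1 hasc (cs.length_mul_of_minimal hwJ ((memJ y).1 hy))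
  have one_memJ : 1 ∈ FJ := (memJ 1).2 (one_mem _)
  have hspan {C : Set W} (hC : ∀ z ∈ C, ∀ i ∈ J, z * cs.simple i ∈ C) {z : W} (hz : z ∈ C) :
      T z * ∑ v ∈ FJ, T v ∈ Submodule.span ℂ (T '' C) := by
    rw [Finset.mul_sum]
    exact sum_mem fun y hy ↦ cs.mul_mem_span_of_mem_closure hT1 hasc hdesc hC
      (Submodule.subset_span ⟨z, hz, rfl⟩) ((memJ y).1 hy)
  have hE : (∑ v ∈ FI, T v) * T w * ∑ v ∈ FJ, T v = ∑ x ∈ FI, T (x * w) * ∑ v ∈ FJ, T v := by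
    rw [Finset.sum_mul, Finset.sum_mul]
    exact Finset.sum_congr rfl fun x hx ↦ by rw [hTxw hx]
  have hED : (∑ v ∈ FI, T v) * T w * ∑ v ∈ FJ, T v ∈ Submodule.span ℂ (T '' (D : Set W)) := by
    rw [hE]
    refine sum_mem fun x hx ↦ hspan (fun z hz i hi ↦ ?_) ?_
    · obtain ⟨x, hx, y, hy, rfl⟩ := (hD z).1 hz
      exact (hD _).2 ⟨x, hx, y * cs.simple i, (memJ _).2 (mul_mem ((memJ y).1 hy) (simpleJ hi)),
        by rw [mul_assoc]⟩
    · exact (hD _).2 ⟨x, hx, 1, one_memJ, by rw [mul_one]⟩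
  -- the coefficient at `w`
  have hcoeff : ψ ((∑ v ∈ FI, T v) * T w * ∑ v ∈ FJ, T v) w = ((∑ v ∈ FK, Q v : ℝ) : ℂ) := by
    have hKconj {x : W} (hx : x ∈ FK) : x ∈ FI ∧ w⁻¹ * x * w ∈ FJ := by
      constructor
      · refine (memI x).2 (Subgroup.closure_mono (fun s hs ↦ hs.1) ((memK x).1 hx))
      · have hle : Subgroup.closure {s | s ∈ cs.simple '' I ∧ w⁻¹ * s * w ∈ cs.simple '' J} ≤
            (Subgroup.closure (cs.simple '' J)).comap (MulAut.conj w⁻¹).toMonoidHom := by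
          rw [Subgroup.closure_le]
          intro s hs
          exact Subgroup.subset_closure (by simpa using hs.2)
        exact (memJ _).2 (by simpa using hle ((memK x).1 hx))
    rw [hE, map_sum, Finsupp.finsetSum_apply, Complex.ofReal_sum]
    symm
    refine Finset.sum_subset_zero_on_sdiff (fun x hx ↦ (hKconj hx).1) (fun x hx ↦ ?_)
      fun x hx ↦ ?_
    · obtain ⟨hxI, hxK⟩ := Finset.mem_sdiff.1 hx
      refine coord_eq_zero_of_notMem hψ
        (hspan (C := {z | (x * w)⁻¹ * z ∈ Subgroup.closure (cs.simple '' J)}) (fun z hz i hi ↦ ?_)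
          ?_)
        fun hmem ↦ hxK ?_
      · rw [Set.mem_ofPred_eq, ← mul_assoc]
        exact mul_mem hz (simpleJ hi)
      · simp
      · refine (memK x).2 (cs.mem_closure_and_weight_eq_of_conj hQ hqconj hw ((memI x).1 hxI)
          (inv_mem hmem) ?_).1
        group
    · obtain ⟨hxI, hxJ⟩ := hKconj hx
      have hxw : x * w = w * (w⁻¹ * x * w) := by group
      rw [(cs.mem_closure_and_weight_eq_of_conj hQ hqconj hw ((memI x).1 hxI)
          ((memJ _).1 hxJ) hxw).2]
      generalize w⁻¹ * x * w = y at hxJ hxw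
      rw [hxw, ← hTwy hxJ, mul_assoc, cs.mul_sum_closure hT1 hasc hdesc hQ hFJ hxJ, mul_smul_comm,
        map_smul, Finsupp.smul_apply, Finset.mul_sum, map_sum, Finsupp.finsetSum_apply,
        Finset.sum_eq_single 1]
      · simp [hT1, hψ]
      · intro v hv hv1
        rw [hTwy hv, hψ, Finsupp.single_eq_of_ne]
        simpa using hv1
      · exact fun h ↦ absurd one_memJ h
  have hqne (i : B) : (q i : ℂ) ≠ 0 := Complex.ofReal_ne_zero.2 (hqpos i).ne'
  have hErange := Submodule.span_mono (Set.image_subset_range T D) hED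
  have hright {i : B} (hi : i ∈ J) := (cs.isHeckeStep_mulRight hasc hdesc i).coord_eq (hqne i) hψ
    hErange (by
      have := (cs.isHeckeStep_mulRight hasc hdesc i).map_sum_eq_smul (F := FJ) fun z hz ↦
        (memJ _).2 (mul_mem ((memJ z).1 hz) (simpleJ hi))
      rw [LinearMap.mulRight_apply] at this ⊢
      rw [mul_assoc, this, mul_smul_comm])
  have hleft {i : B} (hi : i ∈ I) := (cs.isHeckeStep_mulLeft hT1 hasc hdesc i).coord_eq (hqne i) hψ
    hErange (by
      have := (cs.isHeckeStep_mulLeft hT1 hasc hdesc i).map_sum_eq_smul (F := FI) fun z hz ↦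
        (memI _).2 (mul_mem (simpleI hi) ((memI z).1 hz))
      rw [LinearMap.mulLeft_apply] at this ⊢
      rw [mul_assoc, ← mul_assoc, this, smul_mul_assoc])
  generalize (∑ v ∈ FI, T v) * T w * ∑ v ∈ FJ, T v = E at *
  have hconst : ∀ z ∈ D, ψ E z = ψ E w := by
    intro z hz
    obtain ⟨x, hx, y, hy, rfl⟩ := (hD z).1 hz
    rw [memI] at hx
    rw [memJ] at hy
    obtain ⟨α, -, hα, rfl⟩ := cs.exists_isReduced_of_mem_closure hx
    obtain ⟨ω, -, hω, rfl⟩ := cs.exists_isReduced_of_mem_closure hy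
    clear hx hy hz
    induction α with
    | cons i α ih =>
      rw [wordProd_cons, mul_assoc, mul_assoc, hleft (hα i (by simp)), ← mul_assoc]
      exact ih fun j hj ↦ hα j (by simp [hj])
    | nil =>
      induction ω using List.reverseRecOn with
      | nil => simp
      | append_singleton ω i ih =>
        rw [wordProd_append, wordProd_singleton, ← mul_assoc, hright (hω i (by simp))]
        exact ih fun j hj ↦ hω j (by simp [hj])
  rw [← hcoeff, Finset.smul_sum]
  nth_rw 1 [eq_sum_coord_smul hψ hED]
  exact Finset.sum_congr rfl fun z hz ↦ by rw [hconst z hz]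

end CoxeterSystem

/-- Lemma 4.4 of the paper. Let `ℋ` be the Iwahori–Hecke algebra of a
Coxeter system `(W,S)` with positive parameters, and `I, J ⊆ S` spherical. For `w` the
minimal length `(I,J)`-reduced representative,
`P_w^{IJ} := [N(I)/N(I ∩ wJw⁻¹)] · 1_I T_w 1_J` satisfies
`P_w^{IJ} = N(J)⁻¹ Σ_{z ∈ W_I w W_J} T_z`. -/
theorem statement8 {B W : Type*} [Group W] {M : CoxeterMatrix B} (cs : CoxeterSystem M W)
    (q : B → ℝ) (hqpos : ∀ i, 0 < q i)
    (hqconj : ∀ i j : B, IsConj (cs.simple i) (cs.simple j) → q i = q j)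
    (Q : W → ℝ) (hQ : ∀ ω : List B, cs.IsReduced ω → Q (cs.wordProd ω) = (ω.map q).prod)
    (H : Type*) [Ring H] [Algebra ℂ H]
    (T : W → H) (hT1 : T 1 = 1) (hTli : LinearIndependent ℂ T)
    (hasc : ∀ (w : W) (i : B), cs.length (w * cs.simple i) = cs.length w + 1 →
      T w * T (cs.simple i) = T (w * cs.simple i))
    (hdesc : ∀ (w : W) (i : B), cs.length (w * cs.simple i) + 1 = cs.length w →
      T w * T (cs.simple i) =
        ((q i : ℂ)) • T (w * cs.simple i) + ((q i : ℂ) - 1) • T w)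
    (I J : Set B) (w : W)
    (WI WJ WK : Subgroup W)
    (hWI : WI = Subgroup.closure (cs.simple '' I))
    (hWJ : WJ = Subgroup.closure (cs.simple '' J))
    -- `WK` is the standard parabolic on `I ∩ w J w⁻¹ = {s ∈ I : w⁻¹ s w ∈ J}`
    (hWK : WK = Subgroup.closure
      {s | s ∈ cs.simple '' I ∧ w⁻¹ * s * w ∈ cs.simple '' J})
    (hIfin : (WI : Set W).Finite) (hJfin : (WJ : Set W).Finite)
    -- `w` is `(I,J)`-reduced
    (hw : ∀ x ∈ WI, ∀ y ∈ WJ, cs.length w ≤ cs.length (x * w * y))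
    (NI NJ NK : ℝ)
    (hNI : NI = ∑ᶠ v ∈ (WI : Set W), Q v) (hNJ : NJ = ∑ᶠ v ∈ (WJ : Set W), Q v)
    (hNK : NK = ∑ᶠ v ∈ (WK : Set W), Q v)
    (oneI oneJ : H)
    (honeI : oneI = ((NI : ℂ))⁻¹ • ∑ᶠ v ∈ (WI : Set W), T v)
    (honeJ : oneJ = ((NJ : ℂ))⁻¹ • ∑ᶠ v ∈ (WJ : Set W), T v) :
    ((NI / NK : ℝ) : ℂ) • (oneI * T w * oneJ) =
      ((NJ : ℂ))⁻¹ • ∑ᶠ z ∈ {z : W | ∃ x ∈ WI, ∃ y ∈ WJ, z = x * w * y}, T z := by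
  have hKle : WK ≤ WI := by
    rw [hWK, hWI]
    exact Subgroup.closure_mono fun s hs ↦ hs.1
  have hKfin : (WK : Set W).Finite := hIfin.subset hKle
  have hDfin : {z : W | ∃ x ∈ WI, ∃ y ∈ WJ, z = x * w * y}.Finite := by
    refine ((hIfin.prod hJfin).image fun p ↦ p.1 * w * p.2).subset ?_
    rintro z ⟨x, hx, y, hy, rfl⟩
    exact ⟨(x, y), ⟨hx, hy⟩, rfl⟩
  have hpos {P : Subgroup W} (hP : (P : Set W).Finite) : 0 < ∑ v ∈ hP.toFinset, Q v :=
    Finset.sum_pos (fun v _ ↦ cs.weight_pos hQ hqpos v) ⟨1, by simp⟩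
  rw [finsum_mem_eq_finite_toFinset_sum _ hIfin] at hNI honeI
  rw [finsum_mem_eq_finite_toFinset_sum _ hJfin] at honeJ
  rw [finsum_mem_eq_finite_toFinset_sum _ hKfin] at hNK
  have hNI0 : (NI : ℂ) ≠ 0 := Complex.ofReal_ne_zero.2 (hNI ▸ (hpos hIfin).ne')
  have hNK0 : (NK : ℂ) ≠ 0 := Complex.ofReal_ne_zero.2 (hNK ▸ (hpos hKfin).ne')
  have key := cs.sum_mul_mul_sum_eq hT1 hasc hdesc hTli hqpos hqconj hQ (I := I) (J := J) (w := w)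
    (FI := hIfin.toFinset) (FJ := hJfin.toFinset) (FK := hKfin.toFinset) (D := hDfin.toFinset)
    (by rw [← hWI, ← hWJ]; exact hw) (by simp [hWI]) (by simp [hWJ]) (by simp [hWK]) (by simp)
  rw [← hNK] at key
  rw [finsum_mem_eq_finite_toFinset_sum _ hDfin, honeI, honeJ, smul_mul_assoc, smul_mul_assoc,
    mul_smul_comm, key, smul_smul, smul_smul, smul_smul, Complex.ofReal_div]
  congr 1
  field_simp
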